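/- Let P be a positive random field on X^{ℤ^d} and F a filtration, let V and I be disjoint finite nonempty subsets of ℤ^d, and let x̄ ∈ 𝒳_{V∪I}(F) be such that g_{V∪I}^{x̄}(w) > 0 for all w ∈ X^{V∪I}. Suppose H_{V∪I}^{x̄} : X^{V∪I} → ℝ and, for each y ∈ X^I, H_V^{x̄y} : X^V → ℝ are functions representing the transition energies, i.e., Δ_{V∪I}^{x̄}(w,w') = H_{V∪I}^{x̄}(w') − H_{V∪I}^{x̄}(w) for all w, w' ∈ X^{V∪I} and Δ_V^{x̄y}(x,u) = H_V^{x̄y}(u) − H_V^{x̄y}(x) for all x, u ∈ X^V. Then these Hamiltonians are consistent: H_{V∪I}^{x̄}(xy) + H_V^{x̄y}(u) = H_{V∪I}^{x̄}(uy) + H_V^{x̄y}(x) for all x, u ∈ X^V and y ∈ X^I. -/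

import Mathlib

open MeasureTheory Filter Topology

noncomputable section

/-- Sites of the lattice `ℤ^d`. -/
abbrev Site (d : ℕ) := Fin d → ℤ

/-- Configurations on the whole lattice. -/
abbrev Config (d : ℕ) (X : Type*) := Site d → X

variable {d : ℕ} {X : Type*}

/-- The configuration equal to `x` on `V` and to `z` off `V` (the concatenation `xz`). -/
def concat (V : Finset (Site d)) (x z : Config d X) : Config d X :=
  fun t => if t ∈ V then x t else z t

/-- The configuration equal to `u` on `I` and to `y` off `I`. -/
def extCfg (I : Finset (Site d)) (u : {s // s ∈ I} → X) (y : Config d X) : Config d X :=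
  fun t => if h : t ∈ I then u ⟨t, h⟩ else y t

/-- The cylinder set determined by the values of `z` on `Λ`. -/
def cyl (Λ : Finset (Site d)) (z : Config d X) : Set (Config d X) :=
  {ω | ∀ t ∈ Λ, ω t = z t}

/-- Finite-dimensional distribution `P_Λ(z)`. -/
def fdd [MeasurableSpace X] (P : Measure (Config d X)) (Λ : Finset (Site d))
    (z : Config d X) : ℝ :=
  (P (cyl Λ z)).toReal

/-- A positive random field: all finite-dimensional distributions are positive. -/
def IsPositiveRF [MeasurableSpace X] (P : Measure (Config d X)) : Prop :=
  ∀ Λ : Finset (Site d), Λ.Nonempty → ∀ z : Config d X, 0 < fdd P Λ z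

/-- Finite-conditional probability `g_V^z(x)` with boundary condition `z` on `Λ`. -/
def gfin [MeasurableSpace X] (P : Measure (Config d X)) (V Λ : Finset (Site d))
    (x z : Config d X) : ℝ :=
  fdd P (V ∪ Λ) (concat V x z) / fdd P Λ z

/-- A filtration: an increasing sequence of finite subsets of the lattice with union `ℤ^d`. -/
structure Filt (d : ℕ) where
  Λ : ℕ → Finset (Site d)
  mono : Monotone Λ
  covers : ∀ t : Site d, ∃ n, t ∈ Λ n

/-- The set `𝒳_V(F)` of admissible boundary conditions: those `x̄` for which all the limits
`lim_n g_V^{x̄_{Λ_n ∖ V}}(x)` exist. (Only the values of `x̄` off `V` are ever used.) -/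
def admissible [MeasurableSpace X] (P : Measure (Config d X)) (V : Finset (Site d))
    (F : Filt d) : Set (Config d X) :=
  {xb | ∀ x : Config d X, ∃ L : ℝ,
    Tendsto (fun n => gfin P V (F.Λ n \ V) x xb) atTop (𝓝 L)}

/-- The conditional probability `g_V^{x̄}(x)` : the limit of `g_V^{x̄_{Λ_n ∖ V}}(x)`. -/
def gCond [MeasurableSpace X] (P : Measure (Config d X)) (V : Finset (Site d))
    (F : Filt d) (xb x : Config d X) : ℝ :=
  limUnder atTop (fun n => gfin P V (F.Λ n \ V) x xb)

/-- Transition energy `Δ_V^{x̄}(x,u) = ln (g_V^{x̄}(x) / g_V^{x̄}(u))`. -/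
def TE [MeasurableSpace X] (P : Measure (Config d X)) (V : Finset (Site d))
    (F : Filt d) (xb x u : Config d X) : ℝ :=
  Real.log (gCond P V F xb x / gCond P V F xb u)

/-- Quasilocality (on boundary conditions off `V`) of a function `h` on a set `Y` of
boundary conditions. -/
def QuasilocalOn (V : Finset (Site d)) (Y : Set (Config d X)) (h : Config d X → ℝ) : Prop :=
  ∀ ε > 0, ∃ Λε : Finset (Site d), Disjoint Λε V ∧
    ∀ Λ : Finset (Site d), Disjoint Λ V → Λε ⊆ Λ →
      ∀ xb ∈ Y, ∀ yb ∈ Y, (∀ s ∈ Λ, xb s = yb s) → |h xb - h yb| < ε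

/-- `Y` represents a set of boundary conditions on `ℤ^d ∖ {t}`: membership does not depend
on the value at `t`. -/
def IsBCSet (t : Site d) (Y : Set (Config d X)) : Prop :=
  ∀ (ω : Config d X) (a : X), ω ∈ Y → Function.update ω t a ∈ Y

/-- `F` is a determining filtration for `P` with sets `Y t` of admissible boundary conditions:
the one-point finite-conditional probabilities converge, uniformly over `Y t`, to positive
limits, and `P(Y t) = 1`. -/
structure IsDetermining [MeasurableSpace X] (P : Measure (Config d X)) (F : Filt d)
    (Y : Site d → Set (Config d X)) : Prop where
  meas : ∀ t, MeasurableSet (Y t)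
  bc : ∀ t, IsBCSet t (Y t)
  adm : ∀ t, Y t ⊆ admissible P {t} F
  full : ∀ t, P (Y t) = 1
  pos : ∀ t, ∀ xb ∈ Y t, ∀ x : X, 0 < gCond P {t} F xb (fun _ => x)
  unif : ∀ (t : Site d) (x : X), ∀ ε > 0, ∃ N, ∀ n ≥ N, ∀ xb ∈ Y t,
    |gfin P {t} (F.Λ n \ {t}) (fun _ => x) xb - gCond P {t} F xb (fun _ => x)| < ε

/-- The probabilistic (Pr--) definition of a Gibbs random field. -/
def IsGibbsRF [MeasurableSpace X] (P : Measure (Config d X)) : Prop :=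
  IsProbabilityMeasure P ∧ IsPositiveRF P ∧
    ∃ (F : Filt d) (Y : Site d → Set (Config d X)), IsDetermining P F Y

theorem measurableSet_cyl [MeasurableSpace X] [MeasurableSingletonClass X]
    (Λ : Finset (Site d)) (z : Config d X) : MeasurableSet (cyl Λ z) := by
  have h : cyl Λ z = ⋂ t ∈ Λ, (fun ω : Config d X => ω t) ⁻¹' {z t} := by
    ext ω
    simp [cyl]
  rw [h]
  exact Finset.measurableSet_biInter _ fun t _ =>
    measurable_pi_apply t (measurableSet_singleton _)

theorem fdd_pos [MeasurableSpace X] {P : Measure (Config d X)} [IsProbabilityMeasure P]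
    (hP : IsPositiveRF P) (Λ : Finset (Site d)) (z : Config d X) : 0 < fdd P Λ z := by
  rcases Λ.eq_empty_or_nonempty with rfl | hΛ
  · simp [fdd, cyl]
  · exact hP Λ hΛ z

/-- Marginalization: `P_W` is obtained from `P_{V ∪ W}` by summing over configurations on `V`. -/
theorem fdd_eq_sum [Fintype X] [MeasurableSpace X] [MeasurableSingletonClass X]
    (P : Measure (Config d X)) [IsProbabilityMeasure P] {V W : Finset (Site d)}
    (hVW : Disjoint V W) (c : Config d X) :
    fdd P W c =
      ∑ z : {s // s ∈ V} → X, fdd P (V ∪ W) (concat V (extCfg V z c) c) := by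
  have hset : cyl W c =
      ⋃ z : {s // s ∈ V} → X, cyl (V ∪ W) (concat V (extCfg V z c) c) := by
    ext ω
    simp only [cyl, Set.mem_ofPred_eq, Set.mem_iUnion, Finset.mem_union]
    constructor
    · intro h
      refine ⟨fun s => ω s, fun t ht => ?_⟩
      by_cases hV : t ∈ V
      · simp [concat, extCfg, hV]
      · simpa [concat, hV] using h t (ht.resolve_left hV)
    · rintro ⟨z, h⟩ t ht
      have hV : t ∉ V := Finset.disjoint_right.mp hVW ht
      simpa [concat, hV] using h t (Or.inr ht)
  have hdisj : Pairwise fun z z' : {s // s ∈ V} → X =>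
      Disjoint (cyl (V ∪ W) (concat V (extCfg V z c) c))
        (cyl (V ∪ W) (concat V (extCfg V z' c) c)) := by
    intro z z' hne
    refine Set.disjoint_left.mpr fun ω h h' => hne ?_
    funext t
    have h1 := h t (Finset.mem_union_left _ t.2)
    have h2 := h' t (Finset.mem_union_left _ t.2)
    simp only [concat, extCfg, t.2, if_true, dif_pos] at h1 h2
    exact h1.symm.trans h2
  unfold fdd
  rw [hset, measure_iUnion hdisj fun _ => measurableSet_cyl _ _, tsum_fintype,
    ENNReal.toReal_sum fun _ _ => measure_ne_top _ _]

theorem concat_union (V I : Finset (Site d)) (x y z : Config d X) :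
    concat (V ∪ I) (concat V x y) z = concat V x (concat I y z) := by
  funext t
  by_cases hV : t ∈ V <;> by_cases hI : t ∈ I <;> simp [concat, hV, hI]

/-- Bayes' formula: conditioning `g_{V ∪ I}` on the configuration on `I`. -/
theorem gfin_union_div [Fintype X] [MeasurableSpace X] [MeasurableSingletonClass X]
    {P : Measure (Config d X)} [IsProbabilityMeasure P] (hP : IsPositiveRF P)
    {V I Λ : Finset (Site d)} (hI : I ⊆ Λ) (xb x y : Config d X) :
    gfin P V (Λ \ V) x (concat I y xb) =
      gfin P (V ∪ I) (Λ \ (V ∪ I)) (concat V x y) xb /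
        ∑ z : {s // s ∈ V} → X,
          gfin P (V ∪ I) (Λ \ (V ∪ I)) (concat V (extCfg V z (concat I y xb)) y) xb := by
  have hun : V ∪ I ∪ Λ \ (V ∪ I) = V ∪ Λ \ V := by
    ext t
    have := @hI t
    simp only [Finset.mem_union, Finset.mem_sdiff]
    tauto
  have hne := (fdd_pos hP (Λ \ (V ∪ I)) xb).ne'
  simp only [gfin, concat_union, hun]
  rw [← Finset.sum_div, ← fdd_eq_sum P Finset.disjoint_sdiff, div_div_div_cancel_right₀ hne]

theorem tendsto_gCond [MeasurableSpace X] {P : Measure (Config d X)} {V : Finset (Site d)}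
    {F : Filt d} {xb : Config d X} (hxb : xb ∈ admissible P V F) (x : Config d X) :
    Tendsto (fun n => gfin P V (F.Λ n \ V) x xb) atTop (𝓝 (gCond P V F xb x)) :=
  tendsto_nhds_limUnder (hxb x)

theorem Filt.eventually_subset (F : Filt d) (I : Finset (Site d)) :
    ∀ᶠ n in atTop, I ⊆ F.Λ n := by
  have h : ∀ᶠ n in atTop, ∀ t ∈ I, t ∈ F.Λ n := by
    rw [Filter.eventually_all_finset]
    intro t _
    obtain ⟨N, hN⟩ := F.covers t
    filter_upwards [eventually_ge_atTop N] with n hn using F.mono hn hN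
  exact h

theorem gCond_union_div [Fintype X] [MeasurableSpace X] [MeasurableSingletonClass X]
    {P : Measure (Config d X)} [IsProbabilityMeasure P] (hP : IsPositiveRF P) {F : Filt d}
    {V I : Finset (Site d)} {xb : Config d X}
    (hxb : xb ∈ admissible P (V ∪ I) F) (x y : Config d X)
    (hsum : ∑ z : {s // s ∈ V} → X,
      gCond P (V ∪ I) F xb (concat V (extCfg V z (concat I y xb)) y) ≠ 0) :
    gCond P V F (concat I y xb) x = gCond P (V ∪ I) F xb (concat V x y) /
      ∑ z : {s // s ∈ V} → X,
        gCond P (V ∪ I) F xb (concat V (extCfg V z (concat I y xb)) y) := by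
  refine Tendsto.limUnder_eq (Tendsto.congr' ?_ ((tendsto_gCond hxb _).div
    (tendsto_finsetSum _ fun z _ => tendsto_gCond hxb _) hsum))
  filter_upwards [F.eventually_subset I] with n hn
  exact (gfin_union_div hP hn xb x y).symm

/-- consistency of Hamiltonians representing the transition energies. -/
theorem stmt6 [Fintype X] [Nontrivial X] [MeasurableSpace X] [MeasurableSingletonClass X]
    (P : Measure (Config d X)) [IsProbabilityMeasure P] (hP : IsPositiveRF P)
    (F : Filt d) (V I : Finset (Site d)) (hV : V.Nonempty) (hI : I.Nonempty)
    (hVI : Disjoint V I) (xb : Config d X) (hxb : xb ∈ admissible P (V ∪ I) F)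
    (hpos : ∀ w : Config d X, 0 < gCond P (V ∪ I) F xb w)
    (HVI : Config d X → ℝ) (HV : Config d X → Config d X → ℝ)
    (hHVI : ∀ w w' : Config d X, TE P (V ∪ I) F xb w w' = HVI w' - HVI w)
    (hHV : ∀ y x u : Config d X, TE P V F (concat I y xb) x u = HV y u - HV y x) :
    ∀ x u y : Config d X,
      HVI (concat V x y) + HV y u = HVI (concat V u y) + HV y x := by
  intro x u y
  have hsum : 0 < ∑ z : {s // s ∈ V} → X,
      gCond P (V ∪ I) F xb (concat V (extCfg V z (concat I y xb)) y) := by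
    exact Finset.sum_pos (fun z _ => hpos _) Finset.univ_nonempty
  have hTE : TE P V F (concat I y xb) x u = TE P (V ∪ I) F xb (concat V x y) (concat V u y) := by
    simp only [TE]
    rw [gCond_union_div hP hxb x y hsum.ne', gCond_union_div hP hxb u y hsum.ne',
      div_div_div_cancel_right₀ hsum.ne']
  rw [hHV, hHVI] at hTE
  linarith
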